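/- arXiv:2004.10181 — 7 statements merged into one kernel-verified Lean document; each statement's English description precedes it below -/
import Mathlib

section
/- Let Z_1, …, Z_{n+1} be exchangeable real-valued random variables and let α ∈ (0,1). Let Q̂ denote the (1+1/n)α-empirical quantile of Z_1, …, Z_n, i.e. the ⌈(n+1)α⌉-th smallest value among Z_1, …, Z_n, interpreted as +∞ if ⌈(n+1)α⌉ > n. Then P(Z_{n+1} ≤ Q̂) ≥ α. -/
open MeasureTheory Filter

/-- The `k`-th smallest element of a multiset of extended reals (`k` is 1-based), interpreted
as `+∞` when `k` exceeds the number of elements.  For `β > 0`, the `β`-empirical quantile of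
`z_1, …, z_m` is `empQuantile {z_1, …, z_m} ⌈β m⌉`. -/
noncomputable def empQuantile (s : Multiset EReal) (k : ℕ) : EReal :=
  if k ≤ Multiset.card s then (s.sort (· ≤ ·)).getD (k - 1) 0 else ⊤

/-- A point with fewer than `k` elements of `s` strictly below it is at most the `k`-th smallest
element of `s`. -/
lemma le_empQuantile_of_countP_lt {s : Multiset EReal} {k : ℕ} {x : EReal}
    (h : s.countP (· < x) < k) : x ≤ empQuantile s k := by
  unfold empQuantile
  split_ifs with hk
  · set l := s.sort (· ≤ ·) with hl
    have hlen : l.length = Multiset.card s := Multiset.length_sort _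
    have hcount : l.countP (· < x) < k := by
      rw [← Multiset.sort_eq s (· ≤ ·), Multiset.coe_countP] at h
      exact h
    have hk' : k - 1 < l.length := by lia
    rw [List.getD_eq_getElem _ _ hk']
    by_contra! hlt
    have hall : (l.take k).countP (· < x) = (l.take k).length := by
      rw [List.countP_eq_length]
      intro a ha
      obtain ⟨i, hi, rfl⟩ := List.mem_take_iff_getElem.1 ha
      have hle : l[i] ≤ l[k - 1] :=
        (Multiset.pairwise_sort s (· ≤ ·)).sortedLE.getElem_le_getElem_of_le (by lia)
      simpa using hle.trans_lt hlt
    have hsub := (List.take_sublist k l).countP_le (p := (· < x))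
    rw [hall, List.length_take] at hsub
    lia
  · exact le_top

/-- At least `k` entries of a tuple of length `m ≥ k` have fewer than `k` entries strictly
below them. -/
lemma le_card_filter_card_filter_lt {α : Type*} [LinearOrder α] {m k : ℕ} (hk : k ≤ m)
    (z : Fin m → α) :
    k ≤ (Finset.univ.filter
      fun j => (Finset.univ.filter fun i => z i < z j).card < k).card := by
  have hmono : Monotone (z ∘ Tuple.sort z) := Tuple.monotone_sort z
  calc k = (Finset.univ : Finset (Fin k)).card := by simp
    _ ≤ _ := by
      refine Finset.card_le_card_of_injOn (fun a => Tuple.sort z (Fin.castLE hk a)) ?_ ?_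
      · intro a _
        simp only [Finset.coe_filter, Finset.mem_univ, true_and, Set.mem_ofPred_eq]
        refine lt_of_le_of_lt ?_ a.isLt
        calc _ ≤ (Finset.Iio (Fin.castLE hk a)).card := by
              refine Finset.card_le_card_of_injOn (Tuple.sort z).symm ?_
                (Tuple.sort z).symm.injective.injOn
              intro i hi
              simp only [Finset.coe_filter, Finset.mem_univ, true_and, Set.mem_ofPred_eq] at hi
              simp only [Finset.coe_Iio, Set.mem_Iio]
              by_contra! hle
              have := hmono hle
              simp only [Function.comp_apply, Equiv.apply_symm_apply] at this
              exact absurd hi this.not_gt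
          _ = a := by simp
      · intro a _ b _ hab
        exact Fin.castLE_injective hk ((Tuple.sort z).injective hab)

lemma measurableSet_card_filter_lt {ι : Type*} [Fintype ι] (j : ι) (k : ℕ) :
    MeasurableSet {z : ι → ℝ | (Finset.univ.filter fun i => z i < z j).card < k} := by
  simp only [Finset.card_filter]
  have hf : Measurable fun z : ι → ℝ => ∑ i, if z i < z j then 1 else 0 :=
    Finset.measurable_sum _ fun i _ =>
      Measurable.ite (measurableSet_lt (measurable_pi_apply i) (measurable_pi_apply j))
        measurable_const measurable_const
  exact hf (measurableSet_Iio (a := k))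

/-- Let `Z_1, …, Z_{n+1}` be exchangeable real random variables and
`α ∈ (0,1)`.  Let `Q̂` be the `(1+1/n)α`-empirical quantile of `Z_1, …, Z_n`, i.e. the
`⌈(n+1)α⌉`-th smallest value among `Z_1, …, Z_n` (`+∞` if `⌈(n+1)α⌉ > n`).  Then
`P(Z_{n+1} ≤ Q̂) ≥ α`. -/
theorem coverage_lower_bound_inflated_quantile
    (Ω : Type*) [MeasurableSpace Ω] (P : Measure Ω) [IsProbabilityMeasure P]
    (n : ℕ) (hn : 1 ≤ n)
    (Z : Fin (n + 1) → Ω → ℝ) (hZ : ∀ i, Measurable (Z i))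
    (hexch : ∀ π : Equiv.Perm (Fin (n + 1)),
      Measure.map (fun ω i => Z (π i) ω) P = Measure.map (fun ω i => Z i ω) P)
    (α : ℝ) (hα : α ∈ Set.Ioo (0 : ℝ) 1) :
    ENNReal.ofReal α ≤
      P {ω | ((Z (Fin.last n) ω : ℝ) : EReal) ≤
        empQuantile
          (Multiset.map (fun i : Fin n => ((Z (Fin.castSucc i) ω : ℝ) : EReal))
            Finset.univ.val)
          (Nat.ceil (((n : ℝ) + 1) * α))} := by
  set k := Nat.ceil (((n : ℝ) + 1) * α) with hk_def
  have hk : k ≤ n + 1 := by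
    rw [hk_def, Nat.ceil_le]
    push_cast
    nlinarith [hα.2, (Nat.cast_nonneg n : (0 : ℝ) ≤ n)]
  let B : Fin (n + 1) → Set (Fin (n + 1) → ℝ) := fun j =>
    {z | (Finset.univ.filter fun i => z i < z j).card < k}
  have hB : ∀ j, MeasurableSet (B j) := fun j => measurableSet_card_filter_lt j k
  let A : Fin (n + 1) → Set Ω := fun j => (fun ω i => Z i ω) ⁻¹' B j
  have hmeas : Measurable fun ω i => Z i ω := measurable_pi_lambda _ hZ
  have hA : ∀ j, MeasurableSet (A j) := fun j => hmeas (hB j)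
  have hA_eq : ∀ j, P (A j) = P (A (Fin.last n)) := by
    intro j
    let π := Equiv.swap j (Fin.last n)
    have hperm : (fun ω i => Z (π i) ω) ⁻¹' B (Fin.last n) = A j := by
      ext ω
      have hcard : (Finset.univ.filter fun i => Z (π i) ω < Z (π (Fin.last n)) ω).card
          = (Finset.univ.filter fun i => Z i ω < Z j ω).card := by
        refine Finset.card_equiv π fun i => ?_
        simp [π]
      simp only [A, B, Set.mem_preimage, Set.mem_ofPred_eq, hcard]
    have h := congrArg (fun ν => ν (B (Fin.last n))) (hexch π)
    beta_reduce at h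
    rwa [Measure.map_apply (measurable_pi_lambda _ fun i => hZ (π i)) (hB _),
      Measure.map_apply hmeas (hB _), hperm] at h
  have hsum : (k : ENNReal) ≤ ((n + 1 : ℕ) : ENNReal) * P (A (Fin.last n)) := by
    calc (k : ENNReal) = ∫⁻ _, k ∂P := by simp
      _ ≤ ∫⁻ ω, ∑ j, (A j).indicator 1 ω ∂P := by
        refine lintegral_mono fun ω => ?_
        have h := le_card_filter_card_filter_lt hk fun i => Z i ω
        rw [Finset.card_filter] at h
        calc (k : ENNReal) ≤ _ := Nat.cast_le.2 h
          _ = _ := by simp [Set.indicator_apply, A, B]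
      _ = ∑ j, P (A j) := by
        rw [lintegral_finsetSum _ fun j _ => measurable_one.indicator (hA j)]
        simp [lintegral_indicator_one (hA _)]
      _ = _ := by simp [hA_eq]
  have hα_le : ENNReal.ofReal α ≤ P (A (Fin.last n)) := by
    have hn0 : ((n + 1 : ℕ) : ENNReal) ≠ 0 := by simp
    rw [← ENNReal.mul_le_mul_iff_right hn0 (ENNReal.natCast_ne_top _)]
    refine le_trans ?_ hsum
    rw [← ENNReal.ofReal_natCast (n + 1), ← ENNReal.ofReal_mul (Nat.cast_nonneg _),
      ← ENNReal.ofReal_natCast k]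
    refine ENNReal.ofReal_le_ofReal ?_
    push_cast
    exact Nat.le_ceil _
  refine hα_le.trans (measure_mono fun ω hω => le_empQuantile_of_countP_lt ?_)
  refine lt_of_le_of_lt ?_ (show (Finset.univ.filter
    fun i => Z i ω < Z (Fin.last n) ω).card < k from hω)
  rw [Multiset.countP_map]
  simp only [EReal.coe_lt_coe_iff]
  exact Finset.card_le_card_of_injOn (s := Finset.univ.filter
    fun i : Fin n => Z i.castSucc ω < Z (Fin.last n) ω) Fin.castSucc (fun i hi => by simpa using hi)
    (Fin.castSucc_injective n).injOn
end

section
/- Let 𝒳 be a measurable space, K ≥ 1, and let (X_1,Y_1), …, (X_{n+1},Y_{n+1}) be exchangeable random pairs with values in 𝒳 × {1,…,K}, with arbitrary joint distribution. Let I_1, I_2, I_3 be disjoint subsets of {1,…,n} with n_3 = |I_3| ≥ 1, and let ŝ : 𝒳 × {1,…,K} → ℝ and q̂ : 𝒳 → ℝ be jointly measurable random functions that are measurable with respect to σ((X_i,Y_i)_{i ∈ I_1 ∪ I_2}). For i ∈ I_3 define the conformity score E_i = q̂(X_i) − ŝ(X_i,Y_i), let Q̂ be the (1+1/n_3)(1−α)-empirical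 quantile of {E_i}_{i∈I_3}, and define the prediction set Ĉ(x) = {k ∈ {1,…,K} : ŝ(x,k) ≥ q̂(x) − Q̂}. Then P(Y_{n+1} ∈ Ĉ(X_{n+1})) ≥ 1 − α. -/
open MeasureTheory Filter

/-- At least `k` members of a finite family have fewer than `k` members strictly below them. -/
theorem le_card_filter_card_lt {ι : Type*} (J : Finset ι) (f : ι → ℝ) {k : ℕ}
    (hk : k ≤ J.card) :
    k ≤ (J.filter fun j => (J.filter fun i => f i < f j).card < k).card := by
  classical
  by_contra! hlt
  set G := J.filter fun j => (J.filter fun i => f i < f j).card < k with hG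
  have hne : (J \ G).Nonempty := by
    rw [Finset.sdiff_nonempty]
    intro hJG
    exact absurd (Finset.card_le_card hJG) (by omega)
  obtain ⟨j, hj, hmin⟩ := Finset.exists_min_image (J \ G) f hne
  rw [Finset.mem_sdiff] at hj
  refine hj.2 (Finset.mem_filter.2 ⟨hj.1, lt_of_le_of_lt (Finset.card_le_card ?_) hlt⟩)
  intro i hi
  rw [Finset.mem_filter] at hi
  by_contra hiG
  exact absurd (hmin i (Finset.mem_sdiff.2 ⟨hi.1, hiG⟩)) (not_le.2 hi.2)

/-- A number with fewer than `k` elements of `s` strictly below it is at most the `k`-th smallest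
element of `s`. -/
theorem le_empQuantile {s : Multiset EReal} {k : ℕ} {e : EReal}
    (h : (s.filter (· < e)).card < k) : e ≤ empQuantile s k := by
  unfold empQuantile
  split_ifs with hk
  · by_contra! hlt
    have hlen : (s.sort (· ≤ ·)).length = Multiset.card s := Multiset.length_sort _
    have hk' : k - 1 < (s.sort (· ≤ ·)).length := by omega
    rw [List.getD_eq_getElem _ _ hk'] at hlt
    have hall : ∀ a ∈ (s.sort (· ≤ ·)).take k, a < e := by
      intro a ha
      obtain ⟨i, hi, rfl⟩ := List.mem_take_iff_getElem.1 ha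
      refine lt_of_le_of_lt ?_ hlt
      exact (Multiset.pairwise_sort s (· ≤ ·)).sortedLE.getElem_le_getElem_of_le (by omega)
    have hsub : (((s.sort (· ≤ ·)).take k : List EReal) : Multiset EReal) ≤ s.filter (· < e) := by
      refine Multiset.le_filter.2 ⟨?_, fun a ha => hall a (Multiset.mem_coe.1 ha)⟩
      conv_rhs => rw [← Multiset.sort_eq s (· ≤ ·)]
      exact (List.take_sublist _ _).subperm
    have := Multiset.card_le_card hsub
    rw [Multiset.coe_card, List.length_take] at this
    omega
  · exact le_top

/-- If the events "fewer than `k` of the scores `E i`, `i ∈ J`, lie strictly below `E j`" are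
equally likely for all `j ∈ J`, then each of them has probability at least `k / #J`. -/
theorem le_card_mul_measure_card_lt {ι S : Type*} [MeasurableSpace S] (μ : Measure S)
    [IsProbabilityMeasure μ] (J : Finset ι) (E : ι → S → ℝ) (hE : ∀ i, Measurable (E i))
    {l : ι} {k : ℕ} (hk : k ≤ J.card)
    (hsymm : ∀ j ∈ J, μ {w | (J.filter fun i => E i w < E j w).card < k}
      = μ {w | (J.filter fun i => E i w < E l w).card < k}) :
    (k : ENNReal) ≤ J.card * μ {w | (J.filter fun i => E i w < E l w).card < k} := by
  classical
  have hmeas : ∀ j, MeasurableSet {w | (J.filter fun i => E i w < E j w).card < k} := by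
    intro j
    simp only [Finset.card_filter]
    refine measurableSet_lt (Finset.measurable_sum _ fun i _ => ?_) measurable_const
    exact Measurable.ite (measurableSet_lt (hE i) (hE j)) measurable_const measurable_const
  calc (k : ENNReal) = ∫⁻ _, (k : ENNReal) ∂μ := by simp
    _ ≤ ∫⁻ w, ∑ j ∈ J, Set.indicator {w | (J.filter fun i => E i w < E j w).card < k} 1 w ∂μ := by
        refine lintegral_mono fun w => ?_
        have h := le_card_filter_card_lt J (fun i => E i w) hk
        simp only [Set.indicator_apply, Set.mem_ofPred_eq, Pi.one_apply, Finset.sum_boole]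
        exact_mod_cast h
    _ = ∑ j ∈ J, μ {w | (J.filter fun i => E i w < E j w).card < k} := by
        rw [lintegral_finsetSum _ fun j _ => measurable_one.indicator (hmeas j)]
        exact Finset.sum_congr rfl fun j _ => lintegral_indicator_one (hmeas j)
    _ = J.card * μ {w | (J.filter fun i => E i w < E l w).card < k} := by
        rw [Finset.sum_congr rfl hsymm, Finset.sum_const, nsmul_eq_mul]

/-- A function jointly measurable with respect to `σ(Z)` and a second variable factors measurably
through `Z` in its first variable. -/
theorem exists_measurable_factor_prod {Ω 𝒵 𝒳 : Type*} [mZ : MeasurableSpace 𝒵]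
    [mX : MeasurableSpace 𝒳] {Z : Ω → 𝒵} {f : Ω × 𝒳 → ℝ}
    (hf : Measurable[(mZ.comap Z).prod mX] f) :
    ∃ g : 𝒵 × 𝒳 → ℝ, Measurable g ∧ ∀ ω x, f (ω, x) = g (Z ω, x) := by
  have heq : (mZ.comap Z).prod mX = (mZ.prod mX).comap (Prod.map Z id) := by
    simp only [MeasurableSpace.prod, MeasurableSpace.comap_sup, MeasurableSpace.comap_comp]
    rfl
  rw [heq] at hf
  obtain ⟨g, hg, h⟩ := hf.exists_eq_measurable_comp
  exact ⟨g, hg, fun ω x => congrFun h (ω, x)⟩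

/-- Under an exchangeable law, a score `g (w restricted to T, w i)` is below fewer than `k`
others with the same probability for all indices `i` of a set `J` disjoint from `T`. -/
theorem measure_card_lt_eq_of_exchangeable {ι κ 𝒲 : Type*} [DecidableEq ι] [MeasurableSpace 𝒲]
    (μ : Measure (ι → 𝒲))
    (hμ : ∀ π : Equiv.Perm ι, μ.map (fun w i => w (π i)) = μ)
    (t : κ → ι) (J : Finset ι) (ht : ∀ a, t a ∉ J)
    (g : (κ → 𝒲) × 𝒲 → ℝ) (hg : Measurable g) {j l : ι} (hj : j ∈ J) (hl : l ∈ J) (k : ℕ) :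
    μ {w | (J.filter fun i => g (w ∘ t, w i) < g (w ∘ t, w j)).card < k}
      = μ {w | (J.filter fun i => g (w ∘ t, w i) < g (w ∘ t, w l)).card < k} := by
  have hE : ∀ i, Measurable fun w : ι → 𝒲 => g (w ∘ t, w i) := fun i =>
    hg.comp ((measurable_pi_lambda _ fun a => measurable_pi_apply (t a)).prodMk
      (measurable_pi_apply i))
  have hmeas : MeasurableSet {w : ι → 𝒲 |
      (J.filter fun i => g (w ∘ t, w i) < g (w ∘ t, w l)).card < k} := by
    simp only [Finset.card_filter]
    refine measurableSet_lt (Finset.measurable_sum _ fun i _ => ?_) measurable_const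
    exact Measurable.ite (measurableSet_lt (hE i) (hE l)) measurable_const measurable_const
  conv_rhs => rw [← hμ (Equiv.swap j l)]
  rw [Measure.map_apply (measurable_pi_lambda _ fun i => measurable_pi_apply _) hmeas]
  congr 1
  ext w
  have hπ : ∀ i, Equiv.swap j l i ∈ J ↔ i ∈ J := by
    intro i
    rcases eq_or_ne i j with rfl | hij
    · simp [hj, hl]
    rcases eq_or_ne i l with rfl | hil
    · simp [hj, hl]
    rw [Equiv.swap_apply_of_ne_of_ne hij hil]
  have hrestr : (fun i => w (Equiv.swap j l i)) ∘ t = w ∘ t := by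
    funext a
    have h1 : t a ≠ j := fun h => ht a (h ▸ hj)
    have h2 : t a ≠ l := fun h => ht a (h ▸ hl)
    simp [Equiv.swap_apply_of_ne_of_ne h1 h2]
  simp only [Set.mem_preimage, Set.mem_ofPred_eq, hrestr, Equiv.swap_apply_right]
  have hcard : (J.filter fun i => g (w ∘ t, w i) < g (w ∘ t, w j)).card
      = (J.filter fun i => g (w ∘ t, w (Equiv.swap j l i)) < g (w ∘ t, w j)).card := by
    symm
    refine Finset.card_equiv (Equiv.swap j l) fun i => ?_
    simp [Finset.mem_filter, hπ]
  rw [hcard]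

/-- Marginal coverage of split Conformalized Quantile Classification.
`(X_i, Y_i)_{i=1}^{n+1}` are exchangeable pairs with values in `𝒳 × {1,…,K}`; `I₁, I₂, I₃`
are disjoint subsets of `{1,…,n}` with `|I₃| ≥ 1`; the score `ŝ` and quantile function `q̂`
are jointly measurable and measurable with respect to `σ((X_i, Y_i)_{i ∈ I₁ ∪ I₂})`.  With
the conformity scores `E_i = q̂(X_i) − ŝ(X_i, Y_i)` for `i ∈ I₃`, `Q̂` the
`(1+1/n₃)(1−α)`-empirical quantile of `{E_i}_{i ∈ I₃}`, and
`Ĉ(x) = {k : ŝ(x,k) ≥ q̂(x) − Q̂}`, one has `P(Y_{n+1} ∈ Ĉ(X_{n+1})) ≥ 1 − α`. -/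
theorem cqc_marginal_coverage
    {𝒳 : Type*} [MeasurableSpace 𝒳] {Ω : Type*} [MeasurableSpace Ω]
    (P : Measure Ω) [IsProbabilityMeasure P]
    (K : ℕ) (hK : 1 ≤ K) (n : ℕ)
    (X : Fin (n + 1) → Ω → 𝒳) (Y : Fin (n + 1) → Ω → Fin K)
    (hX : ∀ i, Measurable (X i)) (hY : ∀ i, Measurable (Y i))
    (hexch : ∀ π : Equiv.Perm (Fin (n + 1)),
      Measure.map (fun ω i => (X (π i) ω, Y (π i) ω)) P
        = Measure.map (fun ω i => (X i ω, Y i ω)) P)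
    (I₁ I₂ I₃ : Finset (Fin n))
    (h12 : Disjoint I₁ I₂) (h13 : Disjoint I₁ I₃) (h23 : Disjoint I₂ I₃)
    (hI₃ : 1 ≤ I₃.card)
    (α : ℝ) (hα : α ∈ Set.Ioo (0 : ℝ) 1)
    (sh : Ω → 𝒳 → Fin K → ℝ) (qh : Ω → 𝒳 → ℝ)
    (hsh : ∀ k : Fin K,
      Measurable[(MeasurableSpace.comap
          (fun ω (i : {i : Fin n // i ∈ I₁ ∪ I₂}) =>
            (X (Fin.castSucc i.1) ω, Y (Fin.castSucc i.1) ω))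
          inferInstance).prod inferInstance]
        (fun p : Ω × 𝒳 => sh p.1 p.2 k))
    (hqh : Measurable[(MeasurableSpace.comap
          (fun ω (i : {i : Fin n // i ∈ I₁ ∪ I₂}) =>
            (X (Fin.castSucc i.1) ω, Y (Fin.castSucc i.1) ω))
          inferInstance).prod inferInstance]
        (fun p : Ω × 𝒳 => qh p.1 p.2)) :
    ENNReal.ofReal (1 - α) ≤
      P {ω | Y (Fin.last n) ω ∈ {k : Fin K |
          ((qh ω (X (Fin.last n) ω) : ℝ) : EReal)
            - empQuantile
                (Multiset.map (fun i : Fin n =>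
                  ((qh ω (X (Fin.castSucc i) ω)
                      - sh ω (X (Fin.castSucc i) ω) (Y (Fin.castSucc i) ω) : ℝ) : EReal))
                  I₃.val)
                (Nat.ceil (((I₃.card : ℝ) + 1) * (1 - α)))
            ≤ ((sh ω (X (Fin.last n) ω) k : ℝ) : EReal)}} := by
  classical
  obtain ⟨q, hq, hqq⟩ := exists_measurable_factor_prod hqh
  choose s hs hss using fun k => exists_measurable_factor_prod (hsh k)
  let W : Ω → Fin (n + 1) → 𝒳 × Fin K := fun ω i => (X i ω, Y i ω)
  have hW : Measurable W := measurable_pi_lambda _ fun i => (hX i).prodMk (hY i)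
  let t : {i : Fin n // i ∈ I₁ ∪ I₂} → Fin (n + 1) := fun i => Fin.castSucc i.1
  let g : ({i : Fin n // i ∈ I₁ ∪ I₂} → 𝒳 × Fin K) × (𝒳 × Fin K) → ℝ :=
    fun p => q (p.1, p.2.1) - s p.2.2 (p.1, p.2.1)
  have hg : Measurable g := by
    refine (hq.comp (by fun_prop)).sub ?_
    have hs' : Measurable fun r : (({i : Fin n // i ∈ I₁ ∪ I₂} → 𝒳 × Fin K) × 𝒳) × Fin K =>
        s r.2 r.1 := measurable_from_prod_countable_left hs
    exact hs'.comp (f := fun p : ({i : Fin n // i ∈ I₁ ∪ I₂} → 𝒳 × Fin K) × (𝒳 × Fin K) =>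
      ((p.1, p.2.1), p.2.2)) (by fun_prop)
  have hscore : ∀ ω i, qh ω (X i ω) - sh ω (X i ω) (Y i ω) = g (W ω ∘ t, W ω i) := by
    intro ω i
    change _ = q _ - s _ _
    rw [hqq ω (X i ω), hss (Y i ω) ω (X i ω)]
    rfl
  let J : Finset (Fin (n + 1)) := insert (Fin.last n) (I₃.map Fin.castSuccEmb)
  have hlast : Fin.last n ∉ I₃.map Fin.castSuccEmb := by
    simp [Fin.castSucc_ne_last]
  have hJ : J.card = I₃.card + 1 := by
    rw [Finset.card_insert_of_notMem hlast, Finset.card_map]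
  have ht : ∀ a, t a ∉ J := by
    rintro ⟨a, ha⟩ h
    have ha3 : a ∈ I₃ := by simpa [J, t, Fin.castSucc_ne_last] using h
    rcases Finset.mem_union.1 ha with h' | h'
    · exact Finset.disjoint_left.1 h13 h' ha3
    · exact Finset.disjoint_left.1 h23 h' ha3
  set k := Nat.ceil (((I₃.card : ℝ) + 1) * (1 - α)) with hk
  have hkJ : k ≤ J.card := by
    rw [hJ, hk, Nat.ceil_le]
    push_cast
    nlinarith [hα.1, (Nat.cast_nonneg I₃.card : (0 : ℝ) ≤ I₃.card)]
  have hμ : ∀ π : Equiv.Perm (Fin (n + 1)),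
      (P.map W).map (fun w i => w (π i)) = P.map W := by
    intro π
    rw [Measure.map_map (measurable_pi_lambda _ fun i => measurable_pi_apply _) hW]
    exact hexch π
  have : IsProbabilityMeasure (P.map W) := Measure.isProbabilityMeasure_map hW.aemeasurable
  have hlJ : Fin.last n ∈ J := Finset.mem_insert_self _ _
  have hE : ∀ i, Measurable fun w : Fin (n + 1) → 𝒳 × Fin K => g (w ∘ t, w i) := fun i =>
    hg.comp ((measurable_pi_lambda _ fun a => measurable_pi_apply (t a)).prodMk
      (measurable_pi_apply i))
  have hmain := le_card_mul_measure_card_lt (P.map W) J (fun i w => g (w ∘ t, w i)) hE hkJ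
    fun j hj => measure_card_lt_eq_of_exchangeable (P.map W) hμ t J ht g hg hj hlJ k
  set B := {w : Fin (n + 1) → 𝒳 × Fin K |
    (J.filter fun i => g (w ∘ t, w i) < g (w ∘ t, w (Fin.last n))).card < k} with hB
  have hBm : MeasurableSet B := by
    simp only [hB, Finset.card_filter]
    refine measurableSet_lt (Finset.measurable_sum _ fun i _ => ?_) measurable_const
    exact Measurable.ite (measurableSet_lt (hE i) (hE _)) measurable_const measurable_const
  rw [Measure.map_apply hW hBm] at hmain
  have hcov : ENNReal.ofReal (1 - α) ≤ P (W ⁻¹' B) := by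
    have hm : (0 : ℝ) < I₃.card + 1 := by positivity
    have hle : ((I₃.card : ℝ) + 1) * (1 - α) ≤ k := Nat.le_ceil _
    have h1 : (J.card : ENNReal) * ENNReal.ofReal (1 - α) ≤ J.card * P (W ⁻¹' B) := by
      refine le_trans ?_ hmain
      rw [← ENNReal.ofReal_natCast, ← ENNReal.ofReal_natCast,
        ← ENNReal.ofReal_mul (Nat.cast_nonneg _), hJ]
      exact ENNReal.ofReal_le_ofReal (by push_cast; exact hle)
    exact (ENNReal.mul_le_mul_iff_right (by simp [hJ]) (ENNReal.natCast_ne_top _)).1 h1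
  refine hcov.trans (measure_mono fun ω hω => ?_)
  have hω' : (J.filter fun i => g (W ω ∘ t, W ω i) < g (W ω ∘ t, W ω (Fin.last n))).card < k := hω
  simp only [Set.mem_ofPred_eq]
  refine EReal.sub_le_of_le_add ?_
  rw [add_comm, ← EReal.sub_le_iff_le_add (.inl (EReal.coe_ne_bot _)) (.inl (EReal.coe_ne_top _)),
    ← EReal.coe_sub]
  refine le_empQuantile ?_
  refine lt_of_le_of_lt ?_ hω'
  rw [Multiset.filter_map, Multiset.card_map]
  simp only [Function.comp_def, EReal.coe_lt_coe_iff, hscore]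
  rw [← Finset.filter_val, Finset.card_val, ← Finset.card_map Fin.castSuccEmb]
  refine Finset.card_le_card fun i hi => ?_
  obtain ⟨a, ha, rfl⟩ := Finset.mem_map.1 hi
  rw [Finset.mem_filter] at ha ⊢
  exact ⟨Finset.mem_insert_of_mem (Finset.mem_map_of_mem _ ha.1), ha.2⟩
end

section
/- Let 𝒳 be a measurable space, K ≥ 1, let (X,Y) have an arbitrary joint distribution on 𝒳 × {1,…,K}, and let Z be a real random variable independent of (X,Y) whose distribution has a density with respect to Lebesgue measure. Fix α ∈ (0,1) and a measurable score s : 𝒳 × {1,…,K} → ℝ. Define q_α(x) = inf{ z ∈ ℝ : α ≤ P(s(x,Y) ≤ z | X = x) } and, for σ > 0, q^σ_α(x) = inf{ z ∈ ℝ : α ≤ P(s(x,Y) + σZ ≤ z | X = x) }. Define the randomized-oracle set C^σ(X,Z) = {k : s(X,k) + σZ ≥ q^σ_α(X)} and the super-oracle set C(X) = {k : s(X,k) ≥ q_α(X)}. Then lim_{σ → 0} P( C^σ(X,Z) ⊆ C(X) ) = 1. -/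
open MeasureTheory ProbabilityTheory Filter Topology
open scoped ProbabilityTheory ENNReal

/-- If every point eventually belongs to `A i`, then the probability of `A i` tends to one,
even when the sets `A i` are not measurable. -/
theorem tendsto_measure_one_of_eventually_mem {Ω ι : Type*} [MeasurableSpace Ω]
    (μ : Measure Ω) [IsProbabilityMeasure μ] {l : Filter ι} [l.IsCountablyGenerated]
    {A : ι → Set Ω} (hA : ∀ ω, ∀ᶠ i in l, ω ∈ A i) :
    Tendsto (fun i => μ (A i)) l (𝓝 1) := by
  refine tendsto_of_seq_tendsto fun u hu => ?_
  have hmono : Monotone fun n : ℕ => ⋂ m ≥ n, A (u m) := fun n m hnm =>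
    Set.biInter_subset_biInter_left fun _ hk => le_trans hnm hk
  have hunion : ⋃ n : ℕ, ⋂ m ≥ n, A (u m) = Set.univ := by
    refine Set.eq_univ_of_forall fun ω => ?_
    obtain ⟨n, hn⟩ := eventually_atTop.1 (hu.eventually (hA ω))
    exact Set.mem_iUnion.2 ⟨n, Set.mem_iInter₂.2 hn⟩
  have hlim := tendsto_measure_iUnion_atTop (μ := μ) hmono
  rw [hunion, measure_univ] at hlim
  exact tendsto_of_tendsto_of_tendsto_of_le_of_le hlim tendsto_const_nhds
    (fun n => measure_mono (Set.biInter_subset_of_mem (le_refl n))) fun _ => prob_le_one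

/-- For `α < 1`, the set of upper bounds for the `α`-quantile of a random variable is nonempty. -/
theorem nonempty_setOf_le_measure_le {Ω : Type*} [MeasurableSpace Ω] (μ : Measure Ω)
    [IsProbabilityMeasure μ] (f : Ω → ℝ) {α : ℝ} (hα : α < 1) :
    {z : ℝ | α ≤ (μ {ω | f ω ≤ z}).toReal}.Nonempty := by
  have h : Tendsto (fun z : ℝ => μ {ω | f ω ≤ z}) atTop (𝓝 1) :=
    tendsto_measure_one_of_eventually_mem μ fun ω => eventually_ge_atTop (f ω)
  have h' := (ENNReal.tendsto_toReal ENNReal.one_ne_top).comp h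
  exact (h'.eventually (eventually_ge_nhds (by simpa using hα))).exists

/-- A vanishing perturbation does not asymptotically increase the distribution function. -/
theorem eventually_measure_add_mul_le_lt {Ω : Type*} [MeasurableSpace Ω] (μ : Measure Ω)
    [IsProbabilityMeasure μ] {f g : Ω → ℝ} (hf : Measurable f) (hg : Measurable g)
    {α c : ℝ} (hc : (μ {ω | f ω ≤ c}).toReal < α) :
    ∀ᶠ σ in 𝓝[>] (0 : ℝ), (μ {ω | f ω + σ * g ω ≤ c}).toReal < α := by
  have hlim : Tendsto (fun σ : ℝ => μ.real {ω | f ω ≤ c ∨ c < f ω + σ * g ω})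
      (𝓝[>] 0) (𝓝 1) := by
    refine (ENNReal.tendsto_toReal ENNReal.one_ne_top).comp
      (tendsto_measure_one_of_eventually_mem μ fun ω => ?_)
    by_cases hω : f ω ≤ c
    · exact Eventually.of_forall fun _ => Or.inl hω
    · have ht : Tendsto (fun σ : ℝ => f ω + σ * g ω) (𝓝[>] 0) (𝓝 (f ω)) :=
        tendsto_nhdsWithin_of_tendsto_nhds (Continuous.tendsto' (by fun_prop) _ _ (by simp))
      exact (ht.eventually (eventually_gt_nhds (not_le.1 hω))).mono fun _ h => Or.inr h
  filter_upwards [hlim.eventually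
    (eventually_gt_nhds (show 1 - (α - μ.real {ω | f ω ≤ c}) < 1 by
      have : μ.real {ω | f ω ≤ c} < α := hc
      linarith))] with σ hσ
  have hmeas : MeasurableSet {ω | f ω ≤ c ∨ c < f ω + σ * g ω} :=
    (measurableSet_le hf measurable_const).union
      (measurableSet_lt measurable_const (hf.add (hg.const_mul σ)))
  have hsub : {ω | f ω + σ * g ω ≤ c} ⊆
      {ω | f ω ≤ c} ∪ {ω | f ω ≤ c ∨ c < f ω + σ * g ω}ᶜ := by
    intro ω (hω : f ω + σ * g ω ≤ c)
    by_cases h : f ω ≤ c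
    · exact Or.inl h
    · exact Or.inr fun h' => h'.elim h (not_lt.2 hω)
  have h₁ : μ.real {ω | f ω + σ * g ω ≤ c} ≤ _ :=
    (measureReal_mono hsub).trans (measureReal_union_le _ _)
  rw [probReal_compl_eq_one_sub hmeas] at h₁
  change μ.real {ω | f ω + σ * g ω ≤ c} < α
  linarith

/-- Let `(X,Y)` have an arbitrary joint distribution on `𝒳 × {1,…,K}`, let
`Z` be a real random variable independent of `(X,Y)` whose law has a Lebesgue density, and
let `κ` be a regular conditional distribution of `Y` given `X`.  Fix `α ∈ (0,1)` and a
measurable score `s`; let `q_α(x) = inf{z : α ≤ P(s(x,Y) ≤ z | X = x)}` and, for `σ > 0`,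
`q^σ_α(x) = inf{z : α ≤ P(s(x,Y) + σZ ≤ z | X = x)}`.  Then, with
`C^σ(X,Z) = {k : s(X,k) + σZ ≥ q^σ_α(X)}` and `C(X) = {k : s(X,k) ≥ q_α(X)}`,
`P(C^σ(X,Z) ⊆ C(X)) → 1` as `σ → 0⁺`. -/
theorem randomized_oracle_subset_super_oracle
    {𝒳 : Type*} [MeasurableSpace 𝒳] {Ω : Type*} [MeasurableSpace Ω]
    (P : Measure Ω) [IsProbabilityMeasure P]
    (K : ℕ) (hK : 1 ≤ K)
    (X : Ω → 𝒳) (Y : Ω → Fin K) (Z : Ω → ℝ)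
    (hX : Measurable X) (hY : Measurable Y) (hZ : Measurable Z)
    (hindep : IndepFun (fun ω => (X ω, Y ω)) Z P)
    (hdens : ∃ f : ℝ → ENNReal, Measurable f ∧
      Measure.map Z P = MeasureTheory.volume.withDensity f)
    (κ : Kernel 𝒳 (Fin K)) [IsMarkovKernel κ]
    (hκ : Measure.map (fun ω => (X ω, Y ω)) P = (Measure.map X P) ⊗ₘ κ)
    (α : ℝ) (hα : α ∈ Set.Ioo (0 : ℝ) 1)
    (s : 𝒳 → Fin K → ℝ) (hs : Measurable fun p : 𝒳 × Fin K => s p.1 p.2) :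
    Filter.Tendsto
      (fun σ : ℝ =>
        P {ω | ∀ k : Fin K,
          sInf {z : ℝ | α ≤
              (((κ (X ω)).prod (Measure.map Z P))
                {p : Fin K × ℝ | s (X ω) p.1 + σ * p.2 ≤ z}).toReal}
            ≤ s (X ω) k + σ * Z ω →
          sInf {z : ℝ | α ≤ ((κ (X ω)) {k' : Fin K | s (X ω) k' ≤ z}).toReal}
            ≤ s (X ω) k})
      (nhdsWithin 0 (Set.Ioi 0)) (nhds (1 : ℝ≥0∞)) := by
  obtain ⟨hα₀, hα₁⟩ := hα
  have : IsProbabilityMeasure (Measure.map Z P) :=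
    Measure.isProbabilityMeasure_map hZ.aemeasurable
  refine tendsto_measure_one_of_eventually_mem P fun ω => ?_
  refine eventually_all.2 fun k => ?_
  by_cases hk : sInf {z : ℝ | α ≤ ((κ (X ω)) {k' : Fin K | s (X ω) k' ≤ z}).toReal} ≤ s (X ω) k
  · exact Eventually.of_forall fun _ _ => hk
  obtain ⟨c, hkc, hc⟩ := exists_between (not_le.1 hk)
  have hbdd : BddBelow {z : ℝ | α ≤ ((κ (X ω)) {k' : Fin K | s (X ω) k' ≤ z}).toReal} := by
    obtain ⟨b, hb⟩ := (Set.finite_range (s (X ω))).bddBelow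
    refine ⟨b, fun z (hz : α ≤ _) => ?_⟩
    obtain ⟨k', hk'⟩ : {k' : Fin K | s (X ω) k' ≤ z}.Nonempty := by
      rw [Set.nonempty_iff_ne_empty]
      intro he
      rw [he, measure_empty, ENNReal.toReal_zero] at hz
      exact hα₀.not_ge hz
    exact (hb ⟨k', rfl⟩).trans hk'
  have hFc : ((κ (X ω)) {k' : Fin K | s (X ω) k' ≤ c}).toReal < α :=
    not_le.1 fun h => hc.not_ge (csInf_le hbdd h)
  have hprod : (((κ (X ω)).prod (Measure.map Z P))
      {p : Fin K × ℝ | s (X ω) p.1 ≤ c}).toReal < α := by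
    have he : {p : Fin K × ℝ | s (X ω) p.1 ≤ c} =
        {k' : Fin K | s (X ω) k' ≤ c} ×ˢ Set.univ := by
      ext p; simp
    rwa [he, Measure.prod_prod, measure_univ, mul_one]
  have ht : Tendsto (fun σ : ℝ => s (X ω) k + σ * Z ω) (𝓝[>] 0) (𝓝 (s (X ω) k)) :=
    tendsto_nhdsWithin_of_tendsto_nhds (Continuous.tendsto' (by fun_prop) _ _ (by simp))
  filter_upwards [ht.eventually (eventually_lt_nhds hkc),
    eventually_measure_add_mul_le_lt ((κ (X ω)).prod (Measure.map Z P))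
      ((measurable_of_finite (s (X ω))).comp measurable_fst) measurable_snd hprod]
    with σ hσ hFσ hle
  refine absurd (hle.trans_lt hσ) (not_lt.2 ?_)
  refine le_csInf (nonempty_setOf_le_measure_le _ _ hα₁) fun z (hz : α ≤ _) => ?_
  by_contra! hzc
  refine (hz.trans_lt (lt_of_le_of_lt ?_ hFσ)).false
  exact ENNReal.toReal_mono (measure_ne_top _ _)
    (measure_mono fun p (hp : s (X ω) p.1 + σ * p.2 ≤ z) => hp.trans hzc.le)
end

section
/- Let W and Z be independent real random variables and let α ∈ (0,1). For σ ≥ 0 define q^σ_α = inf{ z ∈ ℝ : α ≤ P(W + σZ ≤ z) }. Then liminf_{σ → 0} q^σ_α ≥ q^0_α, where q^0_α = inf{ z ∈ ℝ : α ≤ P(W ≤ z) } is the α-quantile of W. -/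
open MeasureTheory ProbabilityTheory Filter

/-- The distribution function of a real random variable, written with `MeasureTheory.Measure.real`,
is the cumulative distribution function of its law. -/
lemma measureReal_le_eq_cdf_map {Ω : Type*} [MeasurableSpace Ω] (P : Measure Ω)
    [IsProbabilityMeasure P] {V : Ω → ℝ} (hV : Measurable V) (z : ℝ) :
    P.real {ω | V ω ≤ z} = cdf (P.map V) z := by
  have := Measure.isProbabilityMeasure_map (μ := P) hV.aemeasurable
  rw [cdf_eq_real, map_measureReal_apply hV measurableSet_Iic]
  rfl

lemma exists_le_measureReal_le {Ω : Type*} [MeasurableSpace Ω] (P : Measure Ω)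
    [IsProbabilityMeasure P] {V : Ω → ℝ} (hV : Measurable V) {α : ℝ} (hα : α < 1) :
    ∃ z, α ≤ P.real {ω | V ω ≤ z} := by
  obtain ⟨z, hz⟩ := ((tendsto_cdf_atTop (P.map V)).eventually_const_lt hα).exists
  exact ⟨z, by rw [measureReal_le_eq_cdf_map P hV]; exact hz.le⟩

lemma exists_measureReal_le_lt {Ω : Type*} [MeasurableSpace Ω] (P : Measure Ω)
    [IsProbabilityMeasure P] {V : Ω → ℝ} (hV : Measurable V) {ε : ℝ} (hε : 0 < ε) :
    ∃ z < 0, P.real {ω | V ω ≤ z} < ε := by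
  obtain ⟨z, hz, hz0⟩ := (((tendsto_cdf_atBot (P.map V)).eventually_lt_const hε).and
    (eventually_lt_atBot 0)).exists
  exact ⟨z, hz0, by rwa [measureReal_le_eq_cdf_map P hV]⟩

lemma mem_lowerBounds_of_measureReal_le_lt {Ω : Type*} [MeasurableSpace Ω] (P : Measure Ω)
    [IsProbabilityMeasure P] {V : Ω → ℝ} {α t : ℝ} (ht : P.real {ω | V ω ≤ t} < α) :
    t ∈ lowerBounds {z | α ≤ P.real {ω | V ω ≤ z}} := by
  intro z hz
  by_contra! hlt
  exact (hz.trans (measureReal_mono fun ω (hω : V ω ≤ z) => hω.trans hlt.le)).not_gt ht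

lemma bddBelow_setOf_le_measureReal_le {Ω : Type*} [MeasurableSpace Ω] (P : Measure Ω)
    [IsProbabilityMeasure P] {V : Ω → ℝ} (hV : Measurable V) {α : ℝ} (hα : 0 < α) :
    BddBelow {z | α ≤ P.real {ω | V ω ≤ z}} :=
  let ⟨t, _, ht⟩ := exists_measureReal_le_lt P hV hα
  ⟨t, mem_lowerBounds_of_measureReal_le_lt P ht⟩

/-- A value with `P(W ≤ s) < α` stays, after any decrease to `t < s`, below level `α` for the
distribution function of `W + σZ` with `σ` small. -/
lemma eventually_measureReal_add_mul_le_lt {Ω : Type*} [MeasurableSpace Ω] (P : Measure Ω)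
    [IsProbabilityMeasure P] (W : Ω → ℝ) {Z : Ω → ℝ} (hZ : Measurable Z) {α s t : ℝ}
    (hs : P.real {ω | W ω ≤ s} < α) (hts : t < s) :
    ∀ᶠ σ : ℝ in nhdsWithin 0 (Set.Ioi 0), P.real {ω | W ω + σ * Z ω ≤ t} < α := by
  obtain ⟨m, hm0, hm⟩ := exists_measureReal_le_lt P hZ (sub_pos.2 hs)
  have hsmall : 0 < (s - t) / -m := div_pos (sub_pos.2 hts) (neg_pos.2 hm0)
  filter_upwards [Ioo_mem_nhdsGT hsmall] with σ hσ
  have hσm : σ * -m < s - t := (lt_div_iff₀ (neg_pos.2 hm0)).1 hσ.2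
  have hsub : {ω | W ω + σ * Z ω ≤ t} ⊆ {ω | W ω ≤ s} ∪ {ω | Z ω ≤ m} := by
    intro ω hω
    by_contra! h
    simp only [Set.mem_union, Set.mem_ofPred_eq, not_or, not_le] at h hω
    nlinarith [mul_lt_mul_of_pos_left h.2 hσ.1]
  calc P.real {ω | W ω + σ * Z ω ≤ t}
      ≤ P.real ({ω | W ω ≤ s} ∪ {ω | Z ω ≤ m}) := measureReal_mono hsub
    _ ≤ P.real {ω | W ω ≤ s} + P.real {ω | Z ω ≤ m} := measureReal_union_le _ _
    _ < α := by linarith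

/-- Let `W` and `Z` be independent real random variables and `α ∈ (0,1)`.
For `σ ≥ 0` let `q^σ_α = inf{ z : α ≤ P(W + σZ ≤ z) }`. Then
`liminf_{σ → 0⁺} q^σ_α ≥ q^0_α`, where `q^0_α = inf{ z : α ≤ P(W ≤ z) }` is the α-quantile
of `W`. -/
theorem liminf_randomized_quantile_ge (Ω : Type*) [MeasurableSpace Ω]
    (P : Measure Ω) [IsProbabilityMeasure P]
    (W Z : Ω → ℝ) (hW : Measurable W) (hZ : Measurable Z)
    (hWZ : IndepFun W Z P)
    (α : ℝ) (hα : α ∈ Set.Ioo (0 : ℝ) 1) :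
    sInf {z : ℝ | α ≤ (P {ω | W ω ≤ z}).toReal} ≤
      Filter.liminf (fun σ : ℝ => sInf {z : ℝ | α ≤ (P {ω | W ω + σ * Z ω ≤ z}).toReal})
        (nhdsWithin 0 (Set.Ioi 0)) := by
  change sInf {z | α ≤ P.real {ω | W ω ≤ z}} ≤
    liminf (fun σ : ℝ => sInf {z | α ≤ P.real {ω | W ω + σ * Z ω ≤ z}}) (nhdsWithin 0 (Set.Ioi 0))
  have hV (σ : ℝ) : Measurable fun ω => W ω + σ * Z ω := hW.add (hZ.const_mul σ)
  obtain ⟨C, hC⟩ := exists_le_measureReal_le P (hW.add hZ.abs) hα.2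
  have hupper : ∀ᶠ σ : ℝ in nhdsWithin 0 (Set.Ioi 0),
      sInf {z | α ≤ P.real {ω | W ω + σ * Z ω ≤ z}} ≤ C := by
    filter_upwards [Ioo_mem_nhdsGT one_pos] with σ hσ
    refine csInf_le (bddBelow_setOf_le_measureReal_le P (hV σ) hα.1)
      (hC.trans (measureReal_mono fun ω (hω : W ω + |Z ω| ≤ C) => ?_))
    have : σ * Z ω ≤ |Z ω| :=
      (mul_le_mul_of_nonneg_left (le_abs_self _) hσ.1.le).trans
        (mul_le_of_le_one_left (abs_nonneg _) hσ.2.le)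
    exact (by linarith : W ω + σ * Z ω ≤ C)
  refine le_of_forall_lt fun t ht => ?_
  obtain ⟨u, htu, hu⟩ := exists_between ht
  obtain ⟨s, hus, hs⟩ := exists_between hu
  have hsα : P.real {ω | W ω ≤ s} < α :=
    not_le.1 fun h => hs.not_ge (csInf_le (bddBelow_setOf_le_measureReal_le P hW hα.1) h)
  refine htu.trans_le (le_liminf_of_le
    (IsBoundedUnder.isCoboundedUnder_ge (isBoundedUnder_of_eventually_le hupper)) ?_)
  filter_upwards [eventually_measureReal_add_mul_le_lt P W hZ hsα hus] with σ hσ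
  exact le_csInf (exists_le_measureReal_le P (hV σ) hα.2)
    (mem_lowerBounds_of_measureReal_le_lt P hσ)
end

section
/- Let (F_n)_{n≥1} and F be cumulative distribution functions of probability measures on ℝ (nondecreasing, right-continuous, with limits 0 at −∞ and 1 at +∞), and suppose F_n converges weakly to F, i.e. F_n(t) → F(t) at every continuity point t of F. Define the generalized inverses F_n^{-1}(u) = inf{ t ∈ ℝ : u ≤ F_n(t) } and F^{-1}(u) = inf{ t ∈ ℝ : u ≤ F(t) }, and let F^{-1}(u+) = inf_{v > u} F^{-1}(v) denote the right limit of F^{-1} at u. Then for every u ∈ (0,1): F^{-1}(u) ≤ liminf_{n→∞} F_n^{-1}(u) ≤ limsup_{n→∞} F_n^{-1}(u) ≤ F^{-1}(u+). -/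
open Filter Topology

theorem csInf_setOf_le_le {H : ℝ → ℝ} {v x : ℝ} (hmono : Monotone H)
    (hbot : Tendsto H atBot (𝓝 0)) (hv : 0 < v) (hx : v ≤ H x) :
    sInf {t : ℝ | v ≤ H t} ≤ x := by
  obtain ⟨y, hy⟩ := (hbot.eventually_lt_const hv).exists
  refine csInf_le ⟨y, fun t ht => ?_⟩ hx
  by_contra! hty
  exact absurd (ht.trans (hmono hty.le)) hy.not_ge

theorem le_csInf_setOf_le {H : ℝ → ℝ} {v x : ℝ} (hmono : Monotone H)
    (htop : Tendsto H atTop (𝓝 1)) (hv : v < 1) (hx : H x < v) :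
    x ≤ sInf {t : ℝ | v ≤ H t} := by
  obtain ⟨y, hy⟩ := (htop.eventually_const_lt hv).exists
  refine le_csInf ⟨y, hy.le⟩ fun t ht => ?_
  by_contra! htx
  exact absurd (ht.trans (hmono htx.le)) hx.not_ge

theorem Monotone.exists_continuousAt_between {H : ℝ → ℝ} (hmono : Monotone H) {a b : ℝ}
    (hab : a < b) : ∃ x, ContinuousAt H x ∧ a < x ∧ x < b := by
  obtain ⟨x, hx, hxab⟩ := (hmono.countable_not_continuousAt.dense_compl ℝ).exists_between hab
  exact ⟨x, not_not.mp hx, hxab.1, hxab.2⟩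

/-- Let `(F_n)` and `G` be CDFs of probability measures on `ℝ`
(nondecreasing, right-continuous, with limits `0` at `−∞` and `1` at `+∞`), and suppose
`F_n → G` weakly, i.e. `F_n t → G t` at every continuity point `t` of `G`. With the
generalized inverses `F_n⁻¹(u) = inf{t : u ≤ F_n t}`, `G⁻¹(u) = inf{t : u ≤ G t}`, and the
right limit `G⁻¹(u+) = inf_{v > u} G⁻¹(v)`, for every `u ∈ (0,1)`:
`G⁻¹(u) ≤ liminf F_n⁻¹(u) ≤ limsup F_n⁻¹(u) ≤ G⁻¹(u+)`. -/
theorem inverse_cdf_convergence (F : ℕ → ℝ → ℝ) (G : ℝ → ℝ)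
    (hFmono : ∀ n, Monotone (F n))
    (hFrc : ∀ n t, ContinuousWithinAt (F n) (Set.Ici t) t)
    (hFbot : ∀ n, Tendsto (F n) atBot (𝓝 0)) (hFtop : ∀ n, Tendsto (F n) atTop (𝓝 1))
    (hGmono : Monotone G)
    (hGrc : ∀ t, ContinuousWithinAt G (Set.Ici t) t)
    (hGbot : Tendsto G atBot (𝓝 0)) (hGtop : Tendsto G atTop (𝓝 1))
    (hweak : ∀ t, ContinuousAt G t → Tendsto (fun n => F n t) atTop (𝓝 (G t)))
    (u : ℝ) (hu : u ∈ Set.Ioo (0 : ℝ) 1) :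
    sInf {t : ℝ | u ≤ G t} ≤ liminf (fun n => sInf {t : ℝ | u ≤ F n t}) atTop ∧
    liminf (fun n => sInf {t : ℝ | u ≤ F n t}) atTop
      ≤ limsup (fun n => sInf {t : ℝ | u ≤ F n t}) atTop ∧
    limsup (fun n => sInf {t : ℝ | u ≤ F n t}) atTop
      ≤ sInf ((fun v => sInf {t : ℝ | v ≤ G t}) '' Set.Ioo u 1) := by
  have hlow : ∀ a < sInf {t : ℝ | u ≤ G t},
      ∀ᶠ n in atTop, a ≤ sInf {t : ℝ | u ≤ F n t} := by
    intro a ha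
    obtain ⟨x, hxc, hax, hx⟩ := hGmono.exists_continuousAt_between ha
    have hGx : G x < u := by
      by_contra! h
      exact absurd (csInf_setOf_le_le hGmono hGbot hu.1 h) hx.not_ge
    filter_upwards [(hweak x hxc).eventually_lt_const hGx] with n hn
    exact hax.le.trans (le_csInf_setOf_le (hFmono n) (hFtop n) hu.2 hn)
  have hup : ∀ v ∈ Set.Ioo u 1, ∀ b > sInf {t : ℝ | v ≤ G t},
      ∀ᶠ n in atTop, sInf {t : ℝ | u ≤ F n t} ≤ b := by
    intro v hv b hb
    obtain ⟨x, hxc, hx, hxb⟩ := hGmono.exists_continuousAt_between hb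
    have hGx : v ≤ G x := by
      by_contra! h
      exact absurd (le_csInf_setOf_le hGmono hGtop hv.2 h) hx.not_ge
    filter_upwards [(hweak x hxc).eventually_const_lt (hv.1.trans_le hGx)] with n hn
    exact (csInf_setOf_le_le (hFmono n) (hFbot n) hu.1 hn.le).trans hxb.le
  obtain ⟨w, hw⟩ := exists_between hu.2
  have hbelow : IsBoundedUnder (· ≥ ·) atTop (fun n => sInf {t : ℝ | u ≤ F n t}) :=
    ⟨_, eventually_map.mpr (hlow _ (sub_one_lt _))⟩
  have habove : IsBoundedUnder (· ≤ ·) atTop (fun n => sInf {t : ℝ | u ≤ F n t}) :=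
    ⟨_, eventually_map.mpr (hup w hw _ (lt_add_one _))⟩
  refine ⟨le_of_forall_lt_imp_le_of_dense fun a ha =>
      le_liminf_of_le habove.isCoboundedUnder_ge (hlow a ha),
    liminf_le_limsup habove hbelow, le_csInf ⟨_, w, hw, rfl⟩ ?_⟩
  rintro _ ⟨v, hv, rfl⟩
  exact le_of_forall_gt_imp_ge_of_dense fun b hb =>
    limsup_le_of_le hbelow.isCoboundedUnder_le (hup v hv b hb)
end

section
/- Let K ≥ 1, S ⊆ {−1,1}^K, and I ⊆ {1,…,K}. Suppose there are distinct indices i, j ∈ I such that every y ∈ S satisfies y_i = −y_j, and such that there exist y, y' ∈ S with y_i = 1 and y'_i = −1. For u ∈ {−1,1}^I let S_u = { y ∈ S : y_k = u_k for all k ∈ I }. Then the union of rectangle hulls of the slices satisfies |⋃_{u ∈ {−1,1}^I} hull(S_u)| ≤ |hull(S)| / 2. -/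
open scoped Classical

/-- The discrete cube `{−1,1}^K`, realized inside `Fin K → ℤ`. -/
def SignCube (K : ℕ) : Set (Fin K → ℤ) := {y | ∀ k, y k = 1 ∨ y k = -1}

/-- The rectangle hull of `T ⊆ {−1,1}^K`:
`hull(T) = { y ∈ {−1,1}^K : min_{t ∈ T} t k ≤ y k ≤ max_{t ∈ T} t k for every k }` when `T`
is nonempty, and `hull(∅) = ∅`. -/
noncomputable def rectHull (K : ℕ) (T : Set (Fin K → ℤ)) : Set (Fin K → ℤ) :=
  if T.Nonempty then
    {y | y ∈ SignCube K ∧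
      ∀ k, sInf ((fun t => t k) '' T) ≤ y k ∧ y k ≤ sSup ((fun t => t k) '' T)}
  else ∅

theorem signCube_finite (K : ℕ) : (SignCube K).Finite := by
  refine (Set.Finite.pi' (fun _ : Fin K => Set.toFinite ({1, -1} : Set ℤ))).subset ?_
  intro y hy k
  simpa using hy k

theorem mem_rectHull_iff {K : ℕ} {T : Set (Fin K → ℤ)} (hT : T ⊆ SignCube K) {y : Fin K → ℤ} :
    y ∈ rectHull K T ↔ T.Nonempty ∧ y ∈ SignCube K ∧ ∀ k, ∃ t ∈ T, t k = y k := by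
  by_cases hne : T.Nonempty
  · have hbelow : ∀ k, BddBelow ((fun t : Fin K → ℤ => t k) '' T) := fun k =>
      (((signCube_finite K).subset hT).image _).bddBelow
    have habove : ∀ k, BddAbove ((fun t : Fin K → ℤ => t k) '' T) := fun k =>
      (((signCube_finite K).subset hT).image _).bddAbove
    simp only [rectHull, hne, true_and]
    refine and_congr_right fun hy => forall_congr' fun k => ⟨?_, ?_⟩
    · rintro ⟨hle, hge⟩
      rcases hy k with h | h
      · obtain ⟨t, ht, heq⟩ := Int.csSup_mem (hne.image _) (habove k)
        refine ⟨t, ht, ?_⟩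
        have := hT ht k
        dsimp only at heq
        omega
      · obtain ⟨t, ht, heq⟩ := Int.csInf_mem (hne.image _) (hbelow k)
        refine ⟨t, ht, ?_⟩
        have := hT ht k
        dsimp only at heq
        omega
    · rintro ⟨t, ht, heq⟩
      rw [← heq]
      exact ⟨csInf_le (hbelow k) ⟨t, ht, rfl⟩, le_csSup (habove k) ⟨t, ht, rfl⟩⟩
  · simp [rectHull, hne]

/-- Let `K ≥ 1`, `S ⊆ {−1,1}^K`, `I ⊆ {1,…,K}`, and suppose there are
distinct `i, j ∈ I` with `y i = − y j` for every `y ∈ S`, while both `y i = 1` and `y i = −1`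
are realized in `S`. For `u ∈ {−1,1}^I` let `S_u = { y ∈ S : y k = u k for all k ∈ I }`.
Then `|⋃_u hull(S_u)| ≤ |hull(S)| / 2`. -/
theorem union_of_slice_hulls_halves (K : ℕ) (hK : 1 ≤ K)
    (S : Set (Fin K → ℤ)) (hS : S ⊆ SignCube K) (I : Set (Fin K))
    (i j : Fin K) (hij : i ≠ j) (hiI : i ∈ I) (hjI : j ∈ I)
    (hopp : ∀ y ∈ S, y i = - y j)
    (hpos : ∃ y ∈ S, y i = 1) (hneg : ∃ y ∈ S, y i = -1) :
    ((⋃ u ∈ SignCube K, rectHull K {y ∈ S | ∀ k ∈ I, y k = u k}).ncard : ℝ)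
      ≤ ((rectHull K S).ncard : ℝ) / 2 := by
  set U := ⋃ u ∈ SignCube K, rectHull K {y ∈ S | ∀ k ∈ I, y k = u k} with hU
  have hmem : ∀ y ∈ U, y ∈ rectHull K S ∧ y i = - y j := by
    intro y hy
    simp only [hU, Set.mem_iUnion] at hy
    obtain ⟨u, -, hyu⟩ := hy
    rw [mem_rectHull_iff ((Set.sep_subset _ _).trans hS)] at hyu
    obtain ⟨hne, hyc, hk⟩ := hyu
    refine ⟨(mem_rectHull_iff hS).2 ⟨hne.mono (Set.sep_subset _ _), hyc, fun k => ?_⟩, ?_⟩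
    · obtain ⟨t, ht, h⟩ := hk k
      exact ⟨t, ht.1, h⟩
    · obtain ⟨t, ht, h⟩ := hk i
      obtain ⟨t', ht', h'⟩ := hk j
      rw [← h, ← h', hopp t ht.1, ht.2 j hjI, ht'.2 j hjI]
  let flip : (Fin K → ℤ) → Fin K → ℤ := fun y => Function.update y j (- y j)
  have hflip : Function.Involutive flip := fun y => by simp [flip]
  have hfin : (rectHull K S).Finite :=
    (signCube_finite K).subset fun y hy => ((mem_rectHull_iff hS).1 hy).2.1
  have hUsub : U ⊆ rectHull K S := fun y hy => (hmem y hy).1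
  have hflipsub : flip '' U ⊆ rectHull K S := by
    rintro _ ⟨y, hy, rfl⟩
    obtain ⟨hne, hyc, hk⟩ := (mem_rectHull_iff hS).1 (hUsub hy)
    refine (mem_rectHull_iff hS).2 ⟨hne, fun k => ?_, fun k => ?_⟩ <;>
      rcases eq_or_ne k j with rfl | hkj
    · have := hyc k
      simp only [flip, Function.update_self]
      omega
    · simpa [flip, hkj] using hyc k
    · obtain ⟨a, ha, ha1⟩ := hpos
      obtain ⟨b, hb, hb1⟩ := hneg
      have hoa := hopp a ha
      have hob := hopp b hb
      simp only [flip, Function.update_self]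
      rcases hyc k with h | h
      · exact ⟨a, ha, by omega⟩
      · exact ⟨b, hb, by omega⟩
    · simpa [flip, hkj] using hk k
  have hdisj : Disjoint U (flip '' U) := by
    rw [Set.disjoint_left]
    rintro _ hz ⟨y, hy, rfl⟩
    have h1 := (hmem _ hz).2
    have h2 := (hmem y hy).2
    have h3 := ((mem_rectHull_iff hS).1 (hUsub hy)).2.1 j
    simp only [flip, Function.update_self, Function.update_of_ne hij] at h1
    omega
  have hcard := Set.ncard_le_ncard (Set.union_subset hUsub hflipsub) hfin
  rw [Set.ncard_union_eq hdisj (hfin.subset hUsub) (hfin.subset hflipsub),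
    Set.ncard_image_of_injective _ hflip.injective] at hcard
  have : ((U.ncard : ℝ) + U.ncard) ≤ (rectHull K S).ncard := by exact_mod_cast hcard
  linarith
end

section
/- Let 𝒳 be a measurable space, K ≥ 1, let (X,Y) have an arbitrary joint distribution on 𝒳 × {1,…,K}, and let Z be a real random variable independent of (X,Y). Fix σ ≥ 0, α ∈ (0,1), and a measurable score s : 𝒳 × {1,…,K} → ℝ, and define q^σ_α(x) = inf{ z ∈ ℝ : α ≤ P(s(x,Y) + σZ ≤ z | X = x) }. Then the randomized-oracle confidence set C^σ(X,Z) = { k : s(X,k) + σZ ≥ q^σ_α(X) } satisfies P( Y ∈ C^σ(X,Z) ) ≥ 1 − α. -/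
open MeasureTheory ProbabilityTheory Filter
open scoped ProbabilityTheory

/-- The probability integral inequality: a real random variable with law `ν` satisfies
`F(W) < α` with probability at most `α`, where `F` is its distribution function. -/
theorem measure_setOf_measure_Iic_lt_le (ν : Measure ℝ) [IsFiniteMeasure ν] (a : ENNReal) :
    ν {w | ν (Set.Iic w) < a} ≤ a := by
  have hm : MeasurableSet {w | ν (Set.Iic w) < a} := by
    have hmono : Monotone fun w => ν (Set.Iic w) :=
      fun _ _ h => measure_mono (Set.Iic_subset_Iic.2 h)
    exact hmono.measurable measurableSet_Iio
  rw [hm.measure_eq_iSup_isCompact]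
  refine iSup_le fun C => iSup_le fun hCS => iSup_le fun hC => ?_
  rcases C.eq_empty_or_nonempty with rfl | hne
  · simp
  · obtain ⟨w, hw, hmax⟩ := hC.exists_isGreatest hne
    exact (measure_mono fun v hv => hmax hv).trans (hCS hw).le

/-- The values at which the distribution function of `f` reaches a positive level
are bounded below. -/
theorem bddBelow_setOf_le_measure_le {β : Type*} [MeasurableSpace β] (ν : Measure β)
    [IsFiniteMeasure ν] {f : β → ℝ} (hf : Measurable f) {α : ℝ} (hα : 0 < α) :
    BddBelow {z : ℝ | α ≤ (ν {p | f p ≤ z}).toReal} := by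
  have htend : Tendsto (fun z => (ν.map f) (Set.Iic z)) atBot (nhds 0) := by
    have h := tendsto_measure_iInter_atBot (μ := ν.map f) (s := fun z : ℝ => Set.Iic z)
      (fun _ => measurableSet_Iic.nullMeasurableSet)
      (fun _ _ h => Set.Iic_subset_Iic.2 h) ⟨0, measure_ne_top _ _⟩
    have hempty : ⋂ z : ℝ, Set.Iic z = ∅ := by
      ext w
      simpa using exists_lt w
    simpa [hempty, Function.comp_def] using h
  obtain ⟨z₀, hz₀⟩ := (htend.eventually_lt_const (ENNReal.ofReal_pos.2 hα)).exists
  refine ⟨z₀, fun z hz => ?_⟩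
  by_contra! hlt
  have hle : ν {p | f p ≤ z} ≤ (ν.map f) (Set.Iic z₀) := by
    rw [Measure.map_apply hf measurableSet_Iic]
    exact measure_mono fun p (hp : f p ≤ z) => hp.trans hlt.le
  have hge : ENNReal.ofReal α ≤ ν {p | f p ≤ z} :=
    (ENNReal.ofReal_le_iff_le_toReal (measure_ne_top _ _)).2 hz
  exact absurd (hge.trans hle) (not_le.2 hz₀)

/-- Let `(X,Y)` have an arbitrary joint distribution on `𝒳 × {1,…,K}`, let
`Z` be a real random variable independent of `(X,Y)`, let `κ` be a regular conditional
distribution of `Y` given `X` (i.e. `law(X,Y) = law(X) ⊗ₘ κ`), fix `σ ≥ 0`, `α ∈ (0,1)` and a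
measurable score `s`, and let
`q^σ_α(x) = inf{ z : α ≤ P(s(x,Y) + σZ ≤ z | X = x) }`.  Then the randomized-oracle set
`C^σ(X,Z) = {k : s(X,k) + σZ ≥ q^σ_α(X)}` satisfies `P(Y ∈ C^σ(X,Z)) ≥ 1 − α`. -/
theorem randomized_oracle_coverage
    {𝒳 : Type*} [MeasurableSpace 𝒳] {Ω : Type*} [MeasurableSpace Ω]
    (P : Measure Ω) [IsProbabilityMeasure P]
    (K : ℕ) (hK : 1 ≤ K)
    (X : Ω → 𝒳) (Y : Ω → Fin K) (Z : Ω → ℝ)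
    (hX : Measurable X) (hY : Measurable Y) (hZ : Measurable Z)
    (hindep : IndepFun (fun ω => (X ω, Y ω)) Z P)
    (κ : Kernel 𝒳 (Fin K)) [IsMarkovKernel κ]
    (hκ : Measure.map (fun ω => (X ω, Y ω)) P = (Measure.map X P) ⊗ₘ κ)
    (σ : ℝ) (hσ : 0 ≤ σ) (α : ℝ) (hα : α ∈ Set.Ioo (0 : ℝ) 1)
    (s : 𝒳 → Fin K → ℝ) (hs : Measurable fun p : 𝒳 × Fin K => s p.1 p.2) :
    ENNReal.ofReal (1 - α) ≤
      P {ω | sInf {z : ℝ | α ≤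
            (((κ (X ω)).prod (Measure.map Z P))
              {p : Fin K × ℝ | s (X ω) p.1 + σ * p.2 ≤ z}).toReal}
          ≤ s (X ω) (Y ω) + σ * Z ω} := by
  have : IsProbabilityMeasure (P.map Z) := Measure.isProbabilityMeasure_map hZ.aemeasurable
  have : IsProbabilityMeasure (P.map X) := Measure.isProbabilityMeasure_map hX.aemeasurable
  set g : 𝒳 → Fin K × ℝ → ℝ := fun x p => s x p.1 + σ * p.2 with hg
  have hgm : Measurable fun q : 𝒳 × Fin K × ℝ => g q.1 q.2 :=
    (hs.comp (measurable_fst.prodMk measurable_snd.fst)).add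
      (measurable_snd.snd.const_mul σ)
  have hgx (x : 𝒳) : Measurable (g x) := hgm.comp measurable_prodMk_left
  set F : 𝒳 × ℝ → ENNReal := fun q => ((κ q.1).prod (P.map Z)) {p | g q.1 p ≤ q.2} with hF
  have hFm : Measurable F := by
    have ht : MeasurableSet {r : (𝒳 × ℝ) × Fin K × ℝ | g r.1.1 r.2 ≤ r.1.2} :=
      measurableSet_le (hgm.comp (measurable_fst.fst.prodMk measurable_snd)) measurable_fst.snd
    have h := Kernel.measurable_kernel_prodMk_left
      (κ := Kernel.prodMkRight ℝ (κ ×ₖ Kernel.const 𝒳 (P.map Z))) ht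
    simpa [Kernel.prodMkRight_apply, Kernel.prod_apply] using h
  set B : Set ((𝒳 × Fin K) × ℝ) :=
    {r | F (r.1.1, g r.1.1 (r.1.2, r.2)) < ENNReal.ofReal α} with hB
  have hBm : MeasurableSet B := by
    refine measurableSet_lt (hFm.comp (measurable_fst.fst.prodMk ?_)) measurable_const
    exact hgm.comp (measurable_fst.fst.prodMk (measurable_fst.snd.prodMk measurable_snd))
  have hXYZ : Measurable fun ω => ((X ω, Y ω), Z ω) := (hX.prodMk hY).prodMk hZ
  have hlaw : P.map (fun ω => ((X ω, Y ω), Z ω)) = ((P.map X) ⊗ₘ κ).prod (P.map Z) := by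
    rw [← hκ]
    exact (indepFun_iff_map_prod_eq_prod_map_map (hX.prodMk hY).aemeasurable
      hZ.aemeasurable).1 hindep
  have hfiber (x : 𝒳) :
      ∫⁻ y, P.map Z (Prod.mk (x, y) ⁻¹' B) ∂κ x ≤ ENNReal.ofReal α := by
    have hS : MeasurableSet {p : Fin K × ℝ | F (x, g x p) < ENNReal.ofReal α} :=
      measurableSet_lt (hFm.comp (measurable_const.prodMk (hgx x))) measurable_const
    have h := measure_setOf_measure_Iic_lt_le (((κ x).prod (P.map Z)).map (g x))
      (ENNReal.ofReal α)
    simp only [Measure.map_apply (hgx x) measurableSet_Iic] at h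
    calc ∫⁻ y, P.map Z (Prod.mk (x, y) ⁻¹' B) ∂κ x
        = ((κ x).prod (P.map Z)) {p | F (x, g x p) < ENNReal.ofReal α} :=
          (Measure.prod_apply hS).symm
      _ ≤ _ := Measure.le_map_apply (hgx x).aemeasurable _
      _ ≤ ENNReal.ofReal α := h
  have hbad : P ((fun ω => ((X ω, Y ω), Z ω)) ⁻¹' B) ≤ ENNReal.ofReal α := by
    rw [← Measure.map_apply hXYZ hBm, hlaw, Measure.prod_apply hBm,
      Measure.lintegral_compProd (measurable_measure_prodMk_left hBm)]
    calc _ ≤ ∫⁻ _, ENNReal.ofReal α ∂P.map X := lintegral_mono hfiber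
      _ = ENNReal.ofReal α := by simp
  calc ENNReal.ofReal (1 - α) = 1 - ENNReal.ofReal α := by
        rw [ENNReal.ofReal_sub _ hα.1.le, ENNReal.ofReal_one]
    _ ≤ 1 - P ((fun ω => ((X ω, Y ω), Z ω)) ⁻¹' B) := tsub_le_tsub_left hbad 1
    _ = P ((fun ω => ((X ω, Y ω), Z ω)) ⁻¹' B)ᶜ := (prob_compl_eq_one_sub (hXYZ hBm)).symm
    _ ≤ _ := measure_mono fun ω hω => ?_
  refine csInf_le (bddBelow_setOf_le_measure_le _ (hgx (X ω)) hα.1) ?_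
  exact (ENNReal.ofReal_le_iff_le_toReal (measure_ne_top _ _)).1 (not_lt.1 hω)
end
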